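/- Let f_ρ, f_π ∈ C^0(U; (0,∞)) be two positive continuous probability densities with respect to μ and let T be the Knothe–Rosenblatt transport. Then for each k ∈ ℕ the partial derivative ∂_k T_k belongs to C^0(U_k; (0,∞)); the infinite product det dT(y) := lim_{n→∞} ∏_{j=1}^n ∂_j T_j(y_{[j]}) converges uniformly on U to a function in C^0(U; (0,∞)); and f_π(T(y)) · det dT(y) = f_ρ(y) for all y ∈ U. -/

import Mathlib

open MeasureTheory Set Filter Topology

noncomputable section

namespace SparseTransport

/-- The interval `[-1,1]` as a type. -/
abbrev II : Type := Set.Icc (-1 : ℝ) 1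
instance : Nonempty II := ⟨⟨0, by norm_num⟩⟩

/-- `U = [-1,1]^ℕ`. -/
abbrev U : Type := ℕ → II

/-- The uniform probability measure `λ/2` on `[-1,1]`. -/
def muI : Measure II := (2 : ENNReal)⁻¹ • ((volume : Measure ℝ).comap Subtype.val)

/-- The product measure `⊗_{j=1}^k λ/2` on `[-1,1]^k`. -/
def muK (k : ℕ) : Measure (Fin k → II) := Measure.pi fun _ => muI

/-- `μ` is the countable product `⊗_{j∈ℕ} λ/2` on `U`, characterized as the projective
limit of the finite-dimensional products of uniform measures. -/
def IsProductMeasure (μ : Measure U) : Prop :=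
  IsProjectiveLimit μ (fun J : Finset ℕ => Measure.pi fun _ : J => muI)

/-- Concatenation `(y_{[k]}, t)` of `y ∈ [-1,1]^k` with `t ∈ U`. -/
def concat {k : ℕ} (y : Fin k → II) (t : U) : U :=
  fun j => if h : j < k then y ⟨j, h⟩ else t (j - k)

/-- The marginal density `f̂_k(y_{[k]}) = ∫_U f(y_{[k]}, t) dμ(t)`. -/
def marginal (μ : Measure U) (f : U → ℝ) (k : ℕ) (y : Fin k → II) : ℝ :=
  ∫ t, f (concat y t) ∂μ

/-- The conditional density `f_{k+1}(y_{[k+1]}) = f̂_{k+1}(y_{[k+1]}) / f̂_k(y_{[k]})`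
(`k+1` is the paper's index `k`). -/
def condDens (μ : Measure U) (f : U → ℝ) (k : ℕ) (y : Fin (k + 1) → II) : ℝ :=
  marginal μ f (k + 1) y / marginal μ f k (fun j => y j.castSucc)

/-- `F_{k+1}(y_{[k]}, x) = ∫_{-1}^x f_{k+1}(y_{[k]}, t) dμ(t)`, the conditional CDF. -/
def condCDF' (μ : Measure U) (f : U → ℝ) (k : ℕ) (y : Fin k → II) (x : ℝ) : ℝ :=
  ∫ t : II, (if (t : ℝ) ≤ x then condDens μ f k (Fin.snoc y t) else 0) ∂muI

/-- One step of the Knothe–Rosenblatt construction: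
`T_{k+1}(y_{[k]}, t) = (x ↦ F_{π,k+1}(T_{[k]}(y_{[k]}), x))^{-1} (F_{ρ,k+1}(y_{[k]}, t))`. -/
def KRstep (μ : Measure U) (fρ fπ : U → ℝ) (k : ℕ) (yorig ytrans : Fin k → II) (t : II) : II :=
  Function.invFun (fun s : II => condCDF' μ fπ k ytrans (s : ℝ))
    (condCDF' μ fρ k yorig (t : ℝ))

/-- The first `k` components `T_{[k]}` of the KR transport. -/
def KRvec (μ : Measure U) (fρ fπ : U → ℝ) : (k : ℕ) → U → (Fin k → II)
  | 0 => fun _ => Fin.elim0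
  | (k + 1) => fun x =>
      Fin.snoc (KRvec μ fρ fπ k x)
        (KRstep μ fρ fπ k (fun j : Fin k => x j) (KRvec μ fρ fπ k x) (x k))

/-- The `k`-th component of the KR transport (`0`-based: it depends on the
coordinates `0, …, k`). -/
def KRcomp (μ : Measure U) (fρ fπ : U → ℝ) (k : ℕ) (x : U) : II :=
  KRvec μ fρ fπ (k + 1) x (Fin.last k)

/-- The Knothe–Rosenblatt transport `T : U → U` pushing `ρ` forward to `π`. -/
def KRmap (μ : Measure U) (fρ fπ : U → ℝ) (x : U) : U := fun k => KRcomp μ fρ fπ k x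

/-- Replace the `k`-th coordinate of `x ∈ U` by (the projection to `[-1,1]` of) `t ∈ ℝ`. -/
def updCoord (x : U) (k : ℕ) (t : ℝ) : U :=
  Function.update x k (Set.projIcc (-1) 1 (by norm_num) t)

/-- Partial derivative `∂_k g` of `g : U → ℝ` with respect to the `k`-th coordinate
(a derivative within `[-1,1]`). -/
def pderiv (g : U → ℝ) (k : ℕ) (x : U) : ℝ :=
  derivWithin (fun t : ℝ => g (updCoord x k t)) (Set.Icc (-1) 1) ((x k : ℝ))

/-- `∂_k T_k` for the KR transport (0-based components). -/
def pderivKR (μ : Measure U) (fρ fπ : U → ℝ) (k : ℕ) (x : U) : ℝ :=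
  pderiv (fun z => (KRcomp μ fρ fπ k z : ℝ)) k x

/-- A positive continuous probability density on `U` with respect to `μ`. -/
def IsPositiveDensity (μ : Measure U) (f : U → ℝ) : Prop :=
  Continuous f ∧ (∀ x, 0 < f x) ∧ ∫ x, f x ∂μ = 1

lemma muI_univ : muI univ = 1 := by
  rw [muI, Measure.smul_apply,
    (MeasurableEmbedding.subtype_coe measurableSet_Icc).comap_apply, image_univ,
    Subtype.range_coe, Real.volume_Icc, smul_eq_mul]
  norm_num
  exact ENNReal.inv_mul_cancel (by norm_num) (by norm_num)

instance : IsProbabilityMeasure muI := ⟨muI_univ⟩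

lemma integral_muI (g : II → ℝ) :
    ∫ t, g t ∂muI
      = 2⁻¹ * ∫ t in (-1 : ℝ)..1, g (projIcc (-1) 1 (by norm_num) t) := by
  have h := integral_subtype_comap (μ := volume) (s := Icc (-1 : ℝ) 1) measurableSet_Icc
    (fun t => g (projIcc (-1) 1 (by norm_num) t))
  simp only [projIcc_val] at h
  rw [muI, integral_smul_measure, h, intervalIntegral.integral_of_le (by norm_num),
    integral_Icc_eq_integral_Ioc]
  simp

lemma integral_muI_ite_le (g : II → ℝ) (x : II) :
    ∫ t : II, (if (t : ℝ) ≤ x then g t else 0) ∂muI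
      = 2⁻¹ * ∫ t in (-1 : ℝ)..x, g (projIcc (-1) 1 (by norm_num) t) := by
  rw [integral_muI, intervalIntegral.integral_of_le (by norm_num),
    intervalIntegral.integral_of_le x.2.1]
  congr 1
  have hset : Ioc (-1 : ℝ) x = Ioc (-1) 1 ∩ Iic (x : ℝ) := by
    rw [Ioc_inter_Iic, min_eq_right x.2.2]
  rw [hset, ← setIntegral_indicator measurableSet_Iic]
  refine setIntegral_congr_fun measurableSet_Ioc fun t ht => ?_
  simp [indicator, projIcc_of_mem _ (Ioc_subset_Icc_self ht)]

/-- Prepend a coordinate to a sequence. -/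
def cons (s : II) (u : U) : U := fun n => Nat.casesOn n s u

lemma continuous_cons : Continuous fun p : II × U => cons p.1 p.2 := by
  refine continuous_pi fun n => ?_
  cases n with
  | zero => exact continuous_fst
  | succ n => exact (continuous_apply n).comp continuous_snd

lemma concat_snoc {k : ℕ} (y : Fin k → II) (s : II) (u : U) :
    concat (Fin.snoc y s : Fin (k + 1) → II) u = concat y (cons s u) := by
  funext j
  rcases lt_trichotomy j k with h | rfl | h
  · simp [concat, h, h.trans (Nat.lt_succ_self k), Fin.snoc]
  · simp [concat, Fin.snoc, cons]
  · obtain ⟨m, rfl⟩ := Nat.exists_eq_add_of_lt h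
    simp [concat, cons, show ¬ k + m + 1 < k + 1 by lia, show ¬ k + m + 1 < k by lia,
      show k + m + 1 - (k + 1) = m by lia, show k + m + 1 - k = m + 1 by lia]

lemma continuous_concat (k : ℕ) :
    Continuous fun p : (Fin k → II) × U => concat p.1 p.2 := by
  refine continuous_pi fun j => ?_
  by_cases h : j < k
  · simp only [concat, h, dite_true]
    exact (continuous_apply _).comp continuous_fst
  · simp only [concat, h, dite_false]
    exact (continuous_apply _).comp continuous_snd

lemma IsProductMeasure.eq_infinitePi {μ : Measure U} (hμ : IsProductMeasure μ) :
    μ = Measure.infinitePi fun _ => muI :=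
  hμ.unique (Measure.isProjectiveLimit_infinitePi _)

lemma IsProductMeasure.isProbabilityMeasure {μ : Measure U} (hμ : IsProductMeasure μ) :
    IsProbabilityMeasure μ := by
  rw [hμ.eq_infinitePi]; infer_instance

lemma IsProductMeasure.map_cons {μ : Measure U} (hμ : IsProductMeasure μ) :
    (muI.prod μ).map (fun p => cons p.1 p.2) = μ := by
  have := hμ.isProbabilityMeasure
  conv_rhs => rw [hμ.eq_infinitePi]
  refine Measure.eq_infinitePi _ fun s t ht => ?_
  -- enlarge `s` to an initial segment, padding with the whole interval
  classical
  obtain ⟨N, hN⟩ := s.exists_nat_subset_range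
  set t' : ℕ → Set II := fun i => if i ∈ s then t i else univ with ht'
  have htm : ∀ i, MeasurableSet (t' i) := fun i => by
    by_cases h : i ∈ s <;> simp [ht', h, ht]
  have hpre : (fun p : II × U => cons p.1 p.2) ⁻¹' (Set.pi s t)
      = t' 0 ×ˢ Set.pi (Finset.range N) (fun i => t' (i + 1)) := by
    ext ⟨a, u⟩
    simp only [mem_preimage, Set.mem_pi, Finset.mem_coe, mem_prod, Finset.mem_range, ht']
    constructor
    · intro h
      refine ⟨?_, fun i _ => ?_⟩
      · split_ifs with h0
        exacts [h 0 h0, mem_univ _]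
      · split_ifs with h0
        exacts [h (i + 1) h0, mem_univ _]
    · rintro ⟨h0, h⟩ i hi
      cases i with
      | zero => simpa [hi, cons] using h0
      | succ i =>
        have := h i (by have := Finset.mem_range.1 (hN hi); lia)
        simpa [hi, cons] using this
  rw [Measure.map_apply continuous_cons.measurable
    (MeasurableSet.pi s.countable_toSet fun i _ => ht i), hpre, Measure.prod_prod]
  conv_lhs => rw [hμ.eq_infinitePi]
  rw [Measure.infinitePi_pi _ (fun i _ => htm (i + 1)),
    mul_comm, ← Finset.prod_range_succ' (fun i => muI (t' i)),
    ← Finset.prod_subset (hN.trans (Finset.range_mono N.le_succ))]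
  · exact Finset.prod_congr rfl fun i hi => by simp [ht', hi]
  · intro i _ hi
    simp [ht', hi]

section Marginal

variable {μ : Measure U} {f : U → ℝ}

lemma continuous_marginal [IsFiniteMeasure μ] (hf : Continuous f) (k : ℕ) :
    Continuous (marginal μ f k) := by
  have := continuous_parametric_integral_of_continuous (μ := μ)
    (f := fun (y : Fin k → II) (t : U) => f (concat y t))
    (hf.comp (continuous_concat k)) isCompact_univ
  simp only [Measure.restrict_univ] at this
  exact this

lemma integrable_of_continuous {X : Type*} [TopologicalSpace X] [CompactSpace X]
    [MeasurableSpace X] [OpensMeasurableSpace X] {ν : Measure X} [IsFiniteMeasure ν]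
    {g : X → ℝ} (hg : Continuous g) : Integrable g ν :=
  hg.integrable_of_hasCompactSupport (HasCompactSupport.of_compactSpace g)

lemma continuous_concat_right {k : ℕ} (y : Fin k → II) : Continuous fun t : U => concat y t :=
  (continuous_concat k).comp (Continuous.prodMk_right y)

lemma marginal_pos [IsProbabilityMeasure μ] (hf : Continuous f) (hpos : ∀ x, 0 < f x) (k : ℕ)
    (y : Fin k → II) : 0 < marginal μ f k y := by
  refine (integral_pos_iff_support_of_nonneg (fun t => (hpos _).le)
    (integrable_of_continuous (hf.comp (continuous_concat_right y)))).2 ?_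
  have : Function.support (fun t => f (concat y t)) = univ :=
    eq_univ_of_forall fun t => (hpos _).ne'
  simp [this]

lemma integral_marginal_snoc (hμ : IsProductMeasure μ) (hf : Continuous f) (k : ℕ)
    (y : Fin k → II) :
    ∫ s, marginal μ f (k + 1) (Fin.snoc y s) ∂muI = marginal μ f k y := by
  have := hμ.isProbabilityMeasure
  have hc : Continuous fun t : U => f (concat y t) := hf.comp (continuous_concat_right y)
  conv_rhs => rw [marginal, ← hμ.map_cons]
  rw [integral_map continuous_cons.measurable.aemeasurable
    hc.measurable.aestronglyMeasurable,
    integral_prod (fun p : II × U => f (concat y (cons p.1 p.2)))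
      (integrable_of_continuous (hc.comp continuous_cons))]
  simp only [marginal, concat_snoc]

lemma tendstoUniformly_marginal [IsProbabilityMeasure μ] (hf : Continuous f) :
    TendstoUniformly (fun (k : ℕ) (x : U) => marginal μ f k (fun j => x j)) f atTop := by
  rw [Metric.tendstoUniformly_iff]
  intro ε hε
  have hconv : TendstoUniformly
      (fun (k : ℕ) (p : U × U) => concat (fun j : Fin k => p.1 j) p.2) Prod.fst atTop := by
    rw [tendstoUniformly_iff_tendsto, Pi.uniformity, tendsto_iInf]
    refine fun i => tendsto_comap_iff.2 fun s hs => mem_map.2 ?_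
    filter_upwards [(eventually_gt_atTop i).prod_inl ⊤] with q hq
    simpa [concat, hq] using refl_mem_uniformity hs
  have h2 := (CompactSpace.uniformContinuous_of_continuous hf).comp_tendstoUniformly hconv
  rw [Metric.tendstoUniformly_iff] at h2
  filter_upwards [h2 (ε / 2) (by positivity)] with k hk x
  have hint : Integrable (fun t => f (concat (fun j : Fin k => x j) t)) μ :=
    integrable_of_continuous (hf.comp (continuous_concat_right _))
  have : f x - marginal μ f k (fun j => x j)
      = ∫ t, (f x - f (concat (fun j : Fin k => x j) t)) ∂μ := by
    rw [integral_sub (integrable_const _) hint]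
    simp [marginal]
  rw [Real.dist_eq, this, ← Real.norm_eq_abs]
  refine (norm_integral_le_of_norm_le_const (C := ε / 2) (.of_forall fun t => ?_)).trans_lt ?_
  · exact (hk (x, t)).le
  · simp; linarith

end Marginal

section Conditional

variable {μ : Measure U} {f : U → ℝ}

lemma continuous_condDens [IsProbabilityMeasure μ] (hf : IsPositiveDensity μ f) (k : ℕ) :
    Continuous (condDens μ f k) :=
  (continuous_marginal hf.1 _).div
    ((continuous_marginal hf.1 _).comp (continuous_pi fun j => continuous_apply j.castSucc))
    fun _ => (marginal_pos hf.1 hf.2.1 _ _).ne'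

lemma condDens_pos [IsProbabilityMeasure μ] (hf : IsPositiveDensity μ f) (k : ℕ)
    (y : Fin (k + 1) → II) : 0 < condDens μ f k y :=
  div_pos (marginal_pos hf.1 hf.2.1 _ _) (marginal_pos hf.1 hf.2.1 _ _)

lemma integral_condDens (hμ : IsProductMeasure μ) (hf : IsPositiveDensity μ f) (k : ℕ)
    (y : Fin k → II) : ∫ s, condDens μ f k (Fin.snoc y s) ∂muI = 1 := by
  have := hμ.isProbabilityMeasure
  simp only [condDens, Fin.snoc_castSucc]
  rw [integral_div, integral_marginal_snoc hμ hf.1]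
  exact div_self (marginal_pos hf.1 hf.2.1 _ _).ne'

/-- The conditional distribution function, with the conditional density extended from
`[-1,1]` to a continuous positive function on `ℝ`. -/
def extCDF (μ : Measure U) (f : U → ℝ) (k : ℕ) (y : Fin k → II) (x : ℝ) : ℝ :=
  2⁻¹ * ∫ t in (-1 : ℝ)..x, condDens μ f k (Fin.snoc y (projIcc (-1) 1 (by norm_num) t))

lemma condCDF'_eq_extCDF (k : ℕ) (y : Fin k → II) (x : II) :
    condCDF' μ f k y x = extCDF μ f k y x :=
  integral_muI_ite_le (fun t => condDens μ f k (Fin.snoc y t)) x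

lemma extCDF_neg_one (k : ℕ) (y : Fin k → II) : extCDF μ f k y (-1) = 0 := by
  simp [extCDF]

lemma extCDF_one (hμ : IsProductMeasure μ) (hf : IsPositiveDensity μ f) (k : ℕ)
    (y : Fin k → II) : extCDF μ f k y 1 = 1 := by
  rw [extCDF, ← integral_muI fun t => condDens μ f k (Fin.snoc y t), integral_condDens hμ hf]

lemma continuous_condDens_snoc_projIcc [IsProbabilityMeasure μ] (hf : IsPositiveDensity μ f)
    (k : ℕ) : Continuous fun p : (Fin k → II) × ℝ =>
      condDens μ f k (Fin.snoc p.1 (projIcc (-1) 1 (by norm_num) p.2)) :=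
  (continuous_condDens hf k).comp
    (Continuous.finSnoc (A := fun _ => II) continuous_fst (continuous_projIcc.comp continuous_snd))

lemma continuous_extCDF [IsProbabilityMeasure μ] (hf : IsPositiveDensity μ f) (k : ℕ) :
    Continuous fun p : (Fin k → II) × ℝ => extCDF μ f k p.1 p.2 := by
  refine continuous_const.mul
    (intervalIntegral.continuous_parametric_intervalIntegral_of_continuous ?_ continuous_snd)
  exact (continuous_condDens_snoc_projIcc hf k).comp
    ((continuous_fst.comp continuous_fst).prodMk continuous_snd)

lemma hasStrictDerivAt_extCDF [IsProbabilityMeasure μ] (hf : IsPositiveDensity μ f) (k : ℕ)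
    (y : Fin k → II) (x : ℝ) :
    HasStrictDerivAt (extCDF μ f k y)
      (2⁻¹ * condDens μ f k (Fin.snoc y (projIcc (-1) 1 (by norm_num) x))) x := by
  have hc : Continuous fun t : ℝ =>
      condDens μ f k (Fin.snoc y (projIcc (-1) 1 (by norm_num) t)) :=
    (continuous_condDens_snoc_projIcc hf k).comp (Continuous.prodMk_right y)
  exact (intervalIntegral.integral_hasStrictDerivAt_right (hc.intervalIntegrable _ _)
    (hc.stronglyMeasurableAtFilter _ _) hc.continuousAt).const_mul _

lemma strictMono_extCDF [IsProbabilityMeasure μ] (hf : IsPositiveDensity μ f) (k : ℕ)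
    (y : Fin k → II) : StrictMono (extCDF μ f k y) := by
  refine strictMono_of_deriv_pos fun x => ?_
  rw [(hasStrictDerivAt_extCDF hf k y x).hasDerivAt.deriv]
  exact mul_pos (by norm_num) (condDens_pos hf k _)

end Conditional

/-- The derivative of a continuous function `τ` solving `G (τ t) = F t` on a set. -/
lemma _root_.HasDerivWithinAt.of_comp_eq {F G τ : ℝ → ℝ} {F' G' a : ℝ} {s : Set ℝ}
    (hF : HasDerivWithinAt F F' s a) (hG : HasStrictDerivAt G G' (τ a)) (hG' : G' ≠ 0)
    (hτ : ContinuousWithinAt τ s a) (ha : a ∈ s) (h : ∀ t ∈ s, G (τ t) = F t) :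
    HasDerivWithinAt τ (F' / G') s a := by
  have hinv := (hG.to_localInverse hG').hasDerivAt
  rw [h a ha] at hinv
  have hcomp := hinv.comp_hasDerivWithinAt a hF
  rw [div_eq_inv_mul]
  have hev : ∀ᶠ t in 𝓝[s] a, hG.localInverse G G' (τ a) hG' (F t) = τ t := by
    filter_upwards [hτ.eventually (hG.eventually_left_inverse hG'), self_mem_nhdsWithin]
      with t ht hts
    rwa [h t hts] at ht
  exact hcomp.congr_of_eventuallyEq_of_mem (hev.mono fun t ht => ht.symm) ha

section Transport

variable {μ : Measure U} {fρ fπ : U → ℝ}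

lemma extCDF_KRstep (hμ : IsProductMeasure μ) (hρ : IsPositiveDensity μ fρ)
    (hπ : IsPositiveDensity μ fπ) (k : ℕ) (y z : Fin k → II) (t : II) :
    extCDF μ fπ k z (KRstep μ fρ fπ k y z t) = extCDF μ fρ k y t := by
  have := hμ.isProbabilityMeasure
  have hmem : extCDF μ fρ k y t ∈ Icc (extCDF μ fπ k z (-1)) (extCDF μ fπ k z 1) := by
    have hlo := (strictMono_extCDF hρ k y).monotone t.2.1
    have hhi := (strictMono_extCDF hρ k y).monotone t.2.2
    rw [extCDF_neg_one] at hlo ⊢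
    rw [extCDF_one hμ hρ] at hhi
    rw [extCDF_one hμ hπ]
    exact ⟨hlo, hhi⟩
  have hc : Continuous (extCDF μ fπ k z) :=
    (continuous_extCDF hπ k).comp (Continuous.prodMk_right z)
  obtain ⟨s, hs, hst⟩ := intermediate_value_Icc (by norm_num) hc.continuousOn hmem
  have hex : ∃ s : II, condCDF' μ fπ k z (s : ℝ) = condCDF' μ fρ k y (t : ℝ) :=
    ⟨⟨s, hs⟩, by rw [condCDF'_eq_extCDF, condCDF'_eq_extCDF]; exact hst⟩
  have h := Function.invFun_eq hex
  rw [condCDF'_eq_extCDF, condCDF'_eq_extCDF] at h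
  rw [← h, KRstep, condCDF'_eq_extCDF]

lemma continuous_KRstep (hμ : IsProductMeasure μ) (hρ : IsPositiveDensity μ fρ)
    (hπ : IsPositiveDensity μ fπ) (k : ℕ) :
    Continuous fun p : ((Fin k → II) × (Fin k → II)) × II =>
      KRstep μ fρ fπ k p.1.1 p.1.2 p.2 := by
  have := hμ.isProbabilityMeasure
  have hsub : Continuous fun q : (Fin k → II) × II => (q.1, (q.2 : ℝ)) :=
    continuous_fst.prodMk (continuous_subtype_val.comp continuous_snd)
  set Φ : (Fin k → II) × II → (Fin k → II) × ℝ := fun q => (q.1, extCDF μ fπ k q.1 q.2) with hΦ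
  have hΦc : Continuous Φ := continuous_fst.prodMk ((continuous_extCDF hπ k).comp hsub)
  have hΦi : Function.Injective Φ := by
    rintro ⟨z, s⟩ ⟨z', s'⟩ h
    obtain ⟨h₁, h₂⟩ := Prod.mk.inj h
    obtain rfl : z = z' := h₁
    exact Prod.ext rfl (Subtype.ext ((strictMono_extCDF hπ k z).injective h₂))
  have key : Continuous fun p : ((Fin k → II) × (Fin k → II)) × II =>
      (p.1.2, KRstep μ fρ fπ k p.1.1 p.1.2 p.2) := by
    rw [(hΦc.isClosedEmbedding hΦi).isInducing.continuous_iff]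
    have : Continuous fun p : ((Fin k → II) × (Fin k → II)) × II =>
        (p.1.2, extCDF μ fρ k p.1.1 p.2) :=
      (continuous_snd.comp continuous_fst).prodMk ((continuous_extCDF hρ k).comp
        (hsub.comp ((continuous_fst.comp continuous_fst).prodMk continuous_snd)))
    refine this.congr fun p => ?_
    simp only [hΦ, Function.comp_apply, extCDF_KRstep hμ hρ hπ]
  exact continuous_snd.comp key

lemma continuous_KRvec (hμ : IsProductMeasure μ) (hρ : IsPositiveDensity μ fρ)
    (hπ : IsPositiveDensity μ fπ) (k : ℕ) : Continuous (KRvec μ fρ fπ k) := by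
  induction k with
  | zero => exact continuous_pi fun j => j.elim0
  | succ k ih =>
    refine Continuous.finSnoc (A := fun _ => II) ih ((continuous_KRstep hμ hρ hπ k).comp
      (((continuous_pi fun j => continuous_apply _).prodMk ih).prodMk (continuous_apply k)))

lemma KRvec_congr (k : ℕ) {x x' : U} (h : ∀ j < k, x j = x' j) :
    KRvec μ fρ fπ k x = KRvec μ fρ fπ k x' := by
  induction k with
  | zero => rfl
  | succ k ih =>
    have hj : (fun j : Fin k => x j) = fun j : Fin k => x' j :=
      funext fun j => h j (j.2.trans k.lt_succ_self)
    simp only [KRvec, ih fun j hj => h j (hj.trans k.lt_succ_self), h k k.lt_succ_self, hj]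

lemma KRcomp_eq_KRstep (k : ℕ) (x : U) : KRcomp μ fρ fπ k x
    = KRstep μ fρ fπ k (fun j : Fin k => x j) (KRvec μ fρ fπ k x) (x k) := by
  simp [KRcomp, KRvec]

lemma KRvec_eq_KRmap (k : ℕ) (x : U) :
    KRvec μ fρ fπ k x = fun j : Fin k => KRmap μ fρ fπ x j := by
  induction k with
  | zero => exact funext fun j => j.elim0
  | succ k ih =>
    funext j
    refine Fin.lastCases rfl (fun i => ?_) j
    simp only [KRvec, Fin.snoc_castSucc, ih, Fin.val_castSucc]

lemma continuous_KRmap (hμ : IsProductMeasure μ) (hρ : IsPositiveDensity μ fρ)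
    (hπ : IsPositiveDensity μ fπ) : Continuous (KRmap μ fρ fπ) :=
  continuous_pi fun k => (continuous_apply _).comp (continuous_KRvec hμ hρ hπ (k + 1))

lemma snoc_restrict {k : ℕ} (x : U) :
    (Fin.snoc (fun j : Fin k => x j) (x k) : Fin (k + 1) → II) = fun j : Fin (k + 1) => x j := by
  funext j
  refine Fin.lastCases ?_ (fun i => ?_) j <;> simp

lemma pderivKR_eq (hμ : IsProductMeasure μ) (hρ : IsPositiveDensity μ fρ)
    (hπ : IsPositiveDensity μ fπ) (k : ℕ) (x : U) :
    pderivKR μ fρ fπ k x = condDens μ fρ k (fun j => x j)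
      / condDens μ fπ k (fun j => KRmap μ fρ fπ x j) := by
  have := hμ.isProbabilityMeasure
  set y : Fin k → II := fun j => x j with hy
  set z : Fin k → II := KRvec μ fρ fπ k x with hz
  set τ : ℝ → ℝ := fun t =>
    (KRstep μ fρ fπ k y z (projIcc (-1) 1 (by norm_num) t) : ℝ) with hτ
  have hcomp : (fun t : ℝ => (KRcomp μ fρ fπ k (updCoord x k t) : ℝ)) = τ := by
    funext t
    have hupd : ∀ j < k, updCoord x k t j = x j := fun j hj => by simp [updCoord, hj.ne]
    rw [KRcomp_eq_KRstep, KRvec_congr k hupd, funext fun j : Fin k => hupd j j.2]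
    simp [updCoord, hτ, hy, hz]
  have hτk : τ (x k) = KRmap μ fρ fπ x k := by
    simp only [hτ, projIcc_val, KRmap, KRcomp_eq_KRstep, hy, hz]
  have hτc : Continuous τ := continuous_subtype_val.comp
    ((continuous_KRstep hμ hρ hπ k).comp
      ((continuous_const (y := (y, z))).prodMk
        (continuous_projIcc (h := (by norm_num : (-1 : ℝ) ≤ 1)))))
  have hd : HasDerivWithinAt τ _ (Icc (-1) 1) (x k : ℝ) :=
    (hasStrictDerivAt_extCDF hρ k y (x k)).hasDerivAt.hasDerivWithinAt.of_comp_eq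
      (hasStrictDerivAt_extCDF hπ k z (τ (x k)))
      (mul_pos (by norm_num) (condDens_pos hπ k _)).ne' hτc.continuousWithinAt (x k).2
      fun t ht => by
        rw [extCDF_KRstep hμ hρ hπ, projIcc_of_mem _ ht]
  rw [pderivKR, pderiv, hcomp,
    hd.derivWithin (uniqueDiffOn_Icc (by norm_num) _ (x k).2), hτk]
  simp only [projIcc_val]
  rw [mul_div_mul_left _ _ (by norm_num), hz, KRvec_eq_KRmap, hy, snoc_restrict, snoc_restrict]

lemma prod_pderivKR (hμ : IsProductMeasure μ) (hρ : IsPositiveDensity μ fρ)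
    (hπ : IsPositiveDensity μ fπ) (n : ℕ) (x : U) :
    ∏ j ∈ Finset.range n, pderivKR μ fρ fπ j x
      = marginal μ fρ n (fun j => x j) / marginal μ fπ n (fun j => KRmap μ fρ fπ x j) := by
  have := hμ.isProbabilityMeasure
  have marginal_zero {f : U → ℝ} (hf : IsPositiveDensity μ f) (y : Fin 0 → II) :
      marginal μ f 0 y = 1 := by
    simpa [marginal, concat] using! hf.2.2
  induction n with
  | zero => simp [marginal_zero hρ, marginal_zero hπ]
  | succ n ih =>
    rw [Finset.prod_range_succ, ih, pderivKR_eq hμ hρ hπ]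
    have h1 := (marginal_pos (μ := μ) hρ.1 hρ.2.1 n fun j => x j).ne'
    have h2 := (marginal_pos (μ := μ) hπ.1 hπ.2.1 n fun j => KRmap μ fρ fπ x j).ne'
    have h3 := (marginal_pos (μ := μ) hπ.1 hπ.2.1 (n + 1) fun j => KRmap μ fρ fπ x j).ne'
    simp only [condDens, Fin.val_castSucc]
    field_simp

end Transport

/-- Theorem `THM:KNOTHEINF`, part (2).  Let `f_ρ, f_π` be positive
continuous probability densities w.r.t. the product measure `μ` on `U` and let `T` be
the Knothe–Rosenblatt transport.  Then each `∂_k T_k` is continuous and positive, the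
partial products `∏_{j=1}^n ∂_j T_j(y_{[j]})` converge uniformly on `U` to a continuous
positive function `det dT`, and `f_π(T(y)) · det dT(y) = f_ρ(y)` for all `y ∈ U`. -/
theorem KR_determinant
    (μ : Measure U) (hμ : IsProductMeasure μ)
    (fρ fπ : U → ℝ) (hρ : IsPositiveDensity μ fρ) (hπ : IsPositiveDensity μ fπ) :
    (∀ k : ℕ, Continuous (pderivKR μ fρ fπ k) ∧ ∀ x : U, 0 < pderivKR μ fρ fπ k x) ∧
    ∃ detdT : U → ℝ,
      Continuous detdT ∧ (∀ y : U, 0 < detdT y) ∧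
      TendstoUniformly
        (fun (n : ℕ) (y : U) => ∏ j ∈ Finset.range n, pderivKR μ fρ fπ j y)
        detdT atTop ∧
      ∀ y : U, fπ (KRmap μ fρ fπ y) * detdT y = fρ y := by
  have := hμ.isProbabilityMeasure
  have hT := continuous_KRmap hμ hρ hπ
  have hdet : Continuous fun y => fρ y / fπ (KRmap μ fρ fπ y) :=
    hρ.1.div (hπ.1.comp hT) fun y => (hπ.2.1 _).ne'
  refine ⟨fun k => ⟨?_, fun x => ?_⟩, fun y => fρ y / fπ (KRmap μ fρ fπ y), hdet,
    fun y => div_pos (hρ.2.1 _) (hπ.2.1 _), ?_, fun y => mul_div_cancel₀ _ (hπ.2.1 _).ne'⟩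
  · have hr : Continuous fun (x : U) (j : Fin (k + 1)) => x j :=
      continuous_pi fun j => continuous_apply _
    rw [funext (pderivKR_eq hμ hρ hπ k)]
    exact ((continuous_condDens hρ k).comp hr).div
      ((continuous_condDens hπ k).comp (hr.comp hT)) fun x => (condDens_pos hπ k _).ne'
  · rw [pderivKR_eq hμ hρ hπ]
    exact div_pos (condDens_pos hρ k _) (condDens_pos hπ k _)
  · simp only [prod_pderivKR hμ hρ hπ]
    rw [← tendstoLocallyUniformly_iff_tendstoUniformly_of_compactSpace]
    exact (tendstoUniformly_marginal hρ.1).tendstoLocallyUniformly.div₀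
      ((tendstoUniformly_marginal hπ.1).comp (KRmap μ fρ fπ)).tendstoLocallyUniformly
      hρ.1 (hπ.1.comp hT) fun y => (hπ.2.1 _).ne'

end SparseTransport
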